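/- Let d ≥ 1, let H and Q be max-stable dfs with unit Fréchet marginals, and let υ be an exponent measure of H. Let F and G be continuous dfs of Borel probability measures ρ_F, ρ_G on [0,∞)^d such that F ∈ MDA(H), G ∈ MDA(Q) with norming constants a_n = n, and such that for each i ≤ d, lim_{x→∞} (1 − F_i(x))/(1 − G_i(x)) = c_i for some c_i ∈ (0,∞). Then lim_{n→∞} n ∫_{ℝ^d} G(x₁,…,x_d)^n dρ_F(x) = ∫_{(0,∞)^d} Q(x₁,…,x_d) dυ(x) = λ(Q,H). -/

import Mathlib

open MeasureTheory Filter Topology ProbabilityTheory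
open scoped ENNReal

/-- The unit Fréchet distribution function `Φ(x) = exp(-1/x)` for `x > 0`, `0` otherwise. -/
noncomputable def frechet (x : ℝ) : ℝ := if 0 < x then Real.exp (-(1/x)) else 0

/-- The distribution function of a Borel measure on `ℝ^d`. -/
noncomputable def df {d : ℕ} (ρ : Measure (Fin d → ℝ)) (x : Fin d → ℝ) : ℝ :=
  (ρ {y | ∀ i, y i ≤ x i}).toReal

/-- The `i`-th marginal distribution function of a Borel measure on `ℝ^d`. -/
noncomputable def marg {d : ℕ} (ρ : Measure (Fin d → ℝ)) (i : Fin d) (t : ℝ) : ℝ :=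
  (ρ {y | y i ≤ t}).toReal

/-- All one-dimensional marginal dfs equal the unit Fréchet df. -/
def HasFrechetMarginals {d : ℕ} (ρ : Measure (Fin d → ℝ)) : Prop :=
  ∀ (i : Fin d) (t : ℝ), marg ρ i t = frechet t

/-- The measure is concentrated on `[0,∞)^d`. -/
def SupportedOnNonneg {d : ℕ} (ρ : Measure (Fin d → ℝ)) : Prop :=
  ρ {y | ∃ i, y i < 0} = 0

/-- Max-infinite divisibility: for every `t > 0`, `H^t` is again a df of a Borel
probability measure. -/
def MaxID {d : ℕ} (ρ : Measure (Fin d → ℝ)) : Prop :=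
  ∀ t : ℝ, 0 < t → ∃ ν : Measure (Fin d → ℝ), IsProbabilityMeasure ν ∧
    ∀ x, df ν x = (df ρ x) ^ t

/-- Max-stability (for a df with unit Fréchet marginals):
`H(t x₁, …, t x_d) = H(x₁, …, x_d)^(1/t)` for all `t > 0` and `x ∈ (0,∞)^d`. -/
def MaxStable {d : ℕ} (ρ : Measure (Fin d → ℝ)) : Prop :=
  ∀ t : ℝ, 0 < t → ∀ x : Fin d → ℝ, (∀ i, 0 < x i) →
    df ρ (fun i => t * x i) = (df ρ x) ^ (1/t)

/-- `υ` is an exponent measure of the max-id df of `ρ`: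
`υ{y : y_i > x_i for some i} = -ln H(x)` for all `x ∈ (0,∞)^d`. -/
def IsExponentMeasure {d : ℕ} (ρ υ : Measure (Fin d → ℝ)) : Prop :=
  ∀ x : Fin d → ℝ, (∀ i, 0 < x i) →
    (υ {y | ∃ i, x i < y i}).toReal = - Real.log (df ρ x)

/-- The positive orthant `(0,∞)^d`. -/
def posOrthant (d : ℕ) : Set (Fin d → ℝ) := {x | ∀ i, 0 < x i}

/-- `F` is in the max-domain of attraction of `H` with norming constants `a_n = n`:
`F(n x)^n → H(x)` for every `x ∈ (0,∞)^d`. -/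
def MDA {d : ℕ} (ρ ρH : Measure (Fin d → ℝ)) : Prop :=
  ∀ x : Fin d → ℝ, (∀ i, 0 < x i) →
    Tendsto (fun n : ℕ => (df ρ (fun i => (n : ℝ) * x i)) ^ n) atTop (𝓝 (df ρH x))

/-- Convergence of the masses of all sub-boxes of a box, together with pointwise convergence of
monotone integrands to a continuous limit, gives convergence of the integrals over the box. -/
theorem tendsto_setIntegral_box {d : ℕ} (I : BoxIntegral.Box (Fin d))
    {μ : ℕ → Measure (Fin d → ℝ)} {ν : Measure (Fin d → ℝ)}
    (hμfin : ∀ n, IsFiniteMeasure (μ n)) (hνfin : ν I ≠ ∞)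
    (hμ : ∀ J ≤ I, Tendsto (fun n => (μ n).real J) atTop (𝓝 (ν.real J)))
    {g : ℕ → (Fin d → ℝ) → ℝ} {f : (Fin d → ℝ) → ℝ}
    (hg : ∀ n, Monotone (g n)) (hf : Monotone f)
    (hgi : ∀ n, IntegrableOn (g n) I (μ n)) (hfi : IntegrableOn f I ν)
    (hfc : ContinuousOn f (BoxIntegral.Box.Icc I))
    (hgf : ∀ x ∈ BoxIntegral.Box.Icc I, Tendsto (fun n => g n x) atTop (𝓝 (f x))) :
    Tendsto (fun n => ∫ x in I, g n x ∂(μ n)) atTop (𝓝 (∫ x in I, f x ∂ν)) := by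
  have hvol (J : BoxIntegral.Box (Fin d)) : volume (J : Set (Fin d → ℝ)) ≠ ∞ :=
    J.measure_coe_lt_top volume |>.ne
  have hνJ (J) (hJ : J ≤ I) : ν J ≠ ∞ := measure_ne_top_of_subset hJ hνfin
  have hτJ (J) (hJ : J ≤ I) : (ν + volume : Measure (Fin d → ℝ)) J ≠ ∞ := by
    simp [hvol J, hνJ J hJ]
  have hτ0 : 0 < (ν + volume).real (I : Set (Fin d → ℝ)) := by
    refine ENNReal.toReal_pos (fun h => ?_) (hτJ I le_rfl)
    have h0 : volume (I : Set (Fin d → ℝ)) = 0 := by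
      simp only [Measure.add_apply, add_eq_zero] at h
      exact h.2
    rw [I.coe_eq_pi, Real.volume_pi_Ioc] at h0
    obtain ⟨i, -, hi⟩ := Finset.prod_eq_zero_iff.1 h0
    have := I.lower_lt_upper i
    simp only [ENNReal.ofReal_eq_zero] at hi
    linarith
  have key (ε : ℝ) (hε : 0 < ε) : ∀ᶠ n in atTop,
      |∫ x in I, g n x ∂(μ n) - ∫ x in I, f x ∂ν| ≤
        ε * (ν + volume).real (I : Set (Fin d → ℝ)) := by
    refine BoxIntegral.Box.subbox_induction_on (p := fun J => ∀ᶠ n in atTop,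
      |∫ x in J, g n x ∂(μ n) - ∫ x in J, f x ∂ν| ≤
        ε * (ν + volume).real (J : Set (Fin d → ℝ))) I (fun J hJI hJ => ?_) (fun z hz => ?_)
    · set π := BoxIntegral.Prepartition.splitCenter J
      have hle (J') (hJ' : J' ∈ π.boxes) : J' ≤ I := (π.le_of_mem hJ').trans hJI
      have hU : (J : Set (Fin d → ℝ)) = ⋃ J' ∈ π.boxes, (J' : Set (Fin d → ℝ)) :=
        (BoxIntegral.Prepartition.isPartition_splitCenter J).iUnion_eq.symm
      have hdisj : Set.Pairwise (π.boxes : Set (BoxIntegral.Box (Fin d)))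
          (Function.onFun Disjoint fun J' => (J' : Set (Fin d → ℝ))) := π.pairwiseDisjoint
      have hm (J') (_ : J' ∈ π.boxes) : MeasurableSet (J' : Set (Fin d → ℝ)) :=
        J'.measurableSet_coe
      filter_upwards [(Filter.eventually_all_finset π.boxes).2 hJ] with n hn
      rw [hU, integral_biUnion_finset _ hm hdisj fun J' h => (hgi n).mono_set (hle J' h),
        integral_biUnion_finset _ hm hdisj fun J' h => hfi.mono_set (hle J' h),
        measureReal_biUnion_finset hdisj hm (fun J' h => hτJ J' (hle J' h)), Finset.mul_sum,
        ← Finset.sum_sub_distrib]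
      exact (Finset.abs_sum_le_sum_abs _ _).trans (Finset.sum_le_sum hn)
    · refine ⟨{x | |f x - f z| < ε / 4}, ?_, fun J hJI m hzJ hJU _ => ?_⟩
      · have := (hfc z hz) (Metric.ball_mem_nhds _ (by positivity : 0 < ε / 4))
        simpa [Metric.ball, Real.dist_eq] using this
      have hl : |f J.lower - f z| < ε / 4 := hJU J.lower_mem_Icc
      have hu : |f J.upper - f z| < ε / 4 := hJU J.upper_mem_Icc
      rw [abs_lt] at hl hu
      have hIcc := BoxIntegral.Box.le_iff_Icc.1 hJI
      have hvolJ : 0 < volume.real (J : Set (Fin d → ℝ)) := by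
        refine ENNReal.toReal_pos (fun h0 => ?_) (hvol J)
        rw [J.coe_eq_pi, Real.volume_pi_Ioc] at h0
        obtain ⟨i, -, hi⟩ := Finset.prod_eq_zero_iff.1 h0
        have := J.lower_lt_upper i
        simp only [ENNReal.ofReal_eq_zero] at hi
        linarith
      have hτ : (ν + volume).real (J : Set (Fin d → ℝ)) =
          ν.real (J : Set (Fin d → ℝ)) + volume.real (J : Set (Fin d → ℝ)) :=
        measureReal_add_apply (hνJ J hJI) (hvol J)
      have bounds {ρ : Measure (Fin d → ℝ)} {h : (Fin d → ℝ) → ℝ} (hh : Monotone h)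
          (hi : IntegrableOn h J ρ) (hρ : ρ J ≠ ∞) :
          h J.lower * ρ.real J ≤ ∫ x in J, h x ∂ρ ∧
            ∫ x in J, h x ∂ρ ≤ h J.upper * ρ.real J := by
        have hconst (c : ℝ) : ∫ _ in (J : Set (Fin d → ℝ)), c ∂ρ = c * ρ.real J := by
          rw [setIntegral_const, smul_eq_mul, mul_comm]
        rw [← hconst, ← hconst]
        exact ⟨setIntegral_mono_on (integrableOn_const hρ) hi J.measurableSet_coe
            fun x hx => hh (J.coe_subset_Icc hx).1,
          setIntegral_mono_on hi (integrableOn_const hρ) J.measurableSet_coe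
            fun x hx => hh (J.coe_subset_Icc hx).2⟩
      have hfb := bounds hf (hfi.mono_set hJI) (hνJ J hJI)
      have hlim (x) (hx : x ∈ BoxIntegral.Box.Icc J) :
          Tendsto (fun n => g n x * (μ n).real J) atTop (𝓝 (f x * ν.real J)) :=
        (hgf x (hIcc hx)).mul (hμ J hJI)
      have hpos : 0 < ε * volume.real (J : Set (Fin d → ℝ)) := by positivity
      have hν0 : 0 ≤ ν.real (J : Set (Fin d → ℝ)) := measureReal_nonneg
      filter_upwards [(hlim _ J.lower_mem_Icc).eventually_const_lt (sub_lt_self _ hpos),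
        (hlim _ J.upper_mem_Icc).eventually_lt_const (lt_add_of_pos_right _ hpos)] with n h1 h2
      have hgb := bounds (hg n) ((hgi n).mono_set hJI) (measure_ne_top _ _)
      rw [hτ, abs_le]
      constructor <;> nlinarith
  rw [Metric.tendsto_atTop']
  intro ε hε
  have := key (ε / 2 / (ν + volume).real (I : Set (Fin d → ℝ))) (by positivity)
  rw [div_mul_cancel₀ _ hτ0.ne'] at this
  obtain ⟨N, hN⟩ := eventually_atTop.1 this
  exact ⟨N, fun n hn => by rw [Real.dist_eq]; linarith [hN n hn.le]⟩

theorem measurableSet_exists_lt {d : ℕ} (x : Fin d → ℝ) :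
    MeasurableSet {y : Fin d → ℝ | ∃ i, x i < y i} := by
  simp only [Set.ofPred_exists]
  exact MeasurableSet.iUnion fun i => measurableSet_lt measurable_const (measurable_pi_apply i)

/-- Convergence of the masses of the complements of lower orthants gives convergence of the masses
of half-open boxes which are bounded from below in at least one coordinate. -/
theorem tendsto_measureReal_partialBox {d : ℕ}
    {μ : ℕ → Measure (Fin d → ℝ)} {ν : Measure (Fin d → ℝ)}
    (hμfin : ∀ n, IsFiniteMeasure (μ n))
    (hνfin : ∀ x : Fin d → ℝ, (∀ i, 0 < x i) → ν {y | ∃ i, x i < y i} ≠ ∞)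
    (hμ : ∀ x : Fin d → ℝ, (∀ i, 0 < x i) →
      Tendsto (fun n => (μ n).real {y | ∃ i, x i < y i}) atTop (𝓝 (ν.real {y | ∃ i, x i < y i})))
    {S : Finset (Fin d)} (hS : S.Nonempty) (l u : Fin d → ℝ) (hl : ∀ i, 0 < l i) (hlu : l ≤ u) :
    Tendsto (fun n => (μ n).real {y | y ≤ u ∧ ∀ i ∈ S, l i < y i}) atTop
      (𝓝 (ν.real {y | y ≤ u ∧ ∀ i ∈ S, l i < y i})) := by
  have hmeas (S : Finset (Fin d)) (u : Fin d → ℝ) :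
      MeasurableSet {y : Fin d → ℝ | y ≤ u ∧ ∀ i ∈ S, l i < y i} := by
    have h1 : MeasurableSet {y : Fin d → ℝ | y ≤ u} := measurableSet_Iic
    have h2 : MeasurableSet {y : Fin d → ℝ | ∀ i ∈ S, l i < y i} := by
      simp only [Set.ofPred_forall]
      exact MeasurableSet.biInter S.countable_toSet
        fun i _ => measurableSet_lt measurable_const (measurable_pi_apply i)
    exact h1.inter h2
  induction hS using Finset.Nonempty.cons_induction generalizing u with
  | singleton j =>
    set v := Function.update u j (l j) with hv
    have hvu : v ≤ u := update_le_self_iff.2 (hlu j)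
    have hv0 (i) : 0 < v i := by
      rcases eq_or_ne i j with rfl | h
      · simp [hv, hl]
      · simpa [hv, h] using (hl i).trans_le (hlu i)
    have hset : {y : Fin d → ℝ | y ≤ u ∧ ∀ i ∈ ({j} : Finset (Fin d)), l i < y i} =
        {y | ∃ i, v i < y i} \ {y | ∃ i, u i < y i} := by
      ext y
      simp only [Set.mem_ofPred_eq, Finset.mem_singleton, forall_eq, Set.mem_sdiff, not_exists,
        not_lt]
      constructor
      · exact fun h => ⟨⟨j, by simpa [hv] using h.2⟩, h.1⟩
      · rintro ⟨⟨i, hi⟩, h⟩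
        refine ⟨h, ?_⟩
        rcases eq_or_ne i j with rfl | hij
        · simpa [hv] using hi
        · simp only [hv, ne_eq, hij, not_false_eq_true, Function.update_of_ne] at hi
          exact absurd (h i) (not_le.2 hi)
    have hsub : {y : Fin d → ℝ | ∃ i, u i < y i} ⊆ {y | ∃ i, v i < y i} :=
      fun y ⟨i, hi⟩ => ⟨i, (hvu i).trans_lt hi⟩
    rw [hset, measureReal_sdiff hsub (measurableSet_exists_lt u)
      (hνfin v hv0)]
    simp_rw [fun n => measureReal_sdiff (μ := μ n) hsub (measurableSet_exists_lt u)]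
    exact (hμ v hv0).sub (hμ u fun i => (hl i).trans_le (hlu i))
  | cons j S hj hS ih =>
    set v := Function.update u j (l j) with hv
    have hvu : v ≤ u := update_le_self_iff.2 (hlu j)
    have hlv : l ≤ v := by
      intro i
      rcases eq_or_ne i j with rfl | h
      · simp [hv]
      · simpa [hv, h] using hlu i
    have hset : {y : Fin d → ℝ | y ≤ u ∧ ∀ i ∈ Finset.cons j S hj, l i < y i} =
        {y | y ≤ u ∧ ∀ i ∈ S, l i < y i} \ {y | y ≤ v ∧ ∀ i ∈ S, l i < y i} := by
      ext y
      simp only [Set.mem_ofPred_eq, Finset.mem_cons, forall_eq_or_imp, Set.mem_sdiff, not_and]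
      constructor
      · rintro ⟨h, h1, h2⟩
        exact ⟨⟨h, h2⟩, fun h3 => absurd (h3 j) (by simpa [hv] using h1)⟩
      · rintro ⟨⟨h, h2⟩, h3⟩
        refine ⟨h, ?_, h2⟩
        by_contra! h4
        exact h3 (le_update_iff.2 ⟨h4, fun i _ => h i⟩) h2
    have hsub : {y : Fin d → ℝ | y ≤ v ∧ ∀ i ∈ S, l i < y i} ⊆
        {y | y ≤ u ∧ ∀ i ∈ S, l i < y i} := fun y hy => ⟨hy.1.trans hvu, hy.2⟩
    have hfin : ν {y : Fin d → ℝ | y ≤ u ∧ ∀ i ∈ S, l i < y i} ≠ ∞ := by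
      obtain ⟨i, hi⟩ := hS
      have : {y : Fin d → ℝ | y ≤ u ∧ ∀ i ∈ S, l i < y i} ⊆ {y | ∃ i, l i < y i} :=
        fun y hy => ⟨i, hy.2 i hi⟩
      exact measure_ne_top_of_subset this (hνfin l hl)
    rw [hset, measureReal_sdiff hsub (hmeas S v) hfin]
    simp_rw [fun n => measureReal_sdiff (μ := μ n) hsub (hmeas S v)]
    exact (ih u hlu).sub (ih v hlv)

section DistributionFunction

variable {d : ℕ} {ρ : Measure (Fin d → ℝ)}

theorem df_eq_measureReal_Iic (x : Fin d → ℝ) : df ρ x = ρ.real (Set.Iic x) := rfl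

theorem df_nonneg (x : Fin d → ℝ) : 0 ≤ df ρ x := ENNReal.toReal_nonneg

theorem df_le_one [IsProbabilityMeasure ρ] (x : Fin d → ℝ) : df ρ x ≤ 1 := measureReal_le_one

theorem monotone_df [IsFiniteMeasure ρ] : Monotone (df ρ) :=
  fun _ _ h => measureReal_mono (Set.Iic_subset_Iic.2 h)

theorem monotone_marg [IsFiniteMeasure ρ] (i : Fin d) : Monotone (marg ρ i) :=
  fun _ _ h => measureReal_mono fun _ hy => le_trans hy h

theorem marg_nonneg (i : Fin d) (t : ℝ) : 0 ≤ marg ρ i t := ENNReal.toReal_nonneg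

theorem df_le_marg [IsFiniteMeasure ρ] (x : Fin d → ℝ) (i : Fin d) : df ρ x ≤ marg ρ i (x i) :=
  measureReal_mono fun _ hy => hy i

theorem measureReal_exists_lt [IsProbabilityMeasure ρ] (x : Fin d → ℝ) :
    ρ.real {y | ∃ i, x i < y i} = 1 - df ρ x := by
  have : {y : Fin d → ℝ | ∃ i, x i < y i} = (Set.Iic x)ᶜ := by
    ext y
    simp [Pi.le_def]
  rw [this, probReal_compl_eq_one_sub measurableSet_Iic, df_eq_measureReal_Iic]

theorem measureReal_lt_eq_one_sub_marg [IsProbabilityMeasure ρ] (i : Fin d) (t : ℝ) :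
    ρ.real {y | t < y i} = 1 - marg ρ i t := by
  have : {y : Fin d → ℝ | t < y i} = {y | y i ≤ t}ᶜ := by
    ext y
    simp
  rw [this, probReal_compl_eq_one_sub (measurableSet_le (measurable_pi_apply i) measurable_const)]
  rfl

theorem one_sub_df_le_sum [IsProbabilityMeasure ρ] (x : Fin d → ℝ) :
    1 - df ρ x ≤ ∑ i, (1 - marg ρ i (x i)) := by
  rw [← measureReal_exists_lt]
  simp_rw [← measureReal_lt_eq_one_sub_marg]
  have : {y : Fin d → ℝ | ∃ i, x i < y i} = ⋃ i ∈ Finset.univ, {y | x i < y i} := by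
    ext y
    simp
  rw [this]
  exact measureReal_biUnion_finset_le _ _

theorem one_sub_marg_ge [IsProbabilityMeasure ρ] {x z : Fin d → ℝ} (i : Fin d)
    (hxz : ∀ j ≠ i, z j ≤ x j) :
    (1 - df ρ x) - (1 - df ρ z) ≤ 1 - marg ρ i (x i) := by
  rw [← measureReal_exists_lt, ← measureReal_exists_lt, ← measureReal_lt_eq_one_sub_marg,
    sub_le_iff_le_add]
  refine (measureReal_mono ?_).trans (measureReal_union_le _ _)
  rintro y ⟨j, hj⟩
  rcases eq_or_ne j i with rfl | h
  · exact Or.inl hj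
  · exact Or.inr ⟨j, (hxz j h).trans_lt hj⟩

theorem frechet_of_pos {t : ℝ} (ht : 0 < t) : frechet t = Real.exp (-(1 / t)) := if_pos ht

theorem df_le_exp [IsFiniteMeasure ρ] (hm : HasFrechetMarginals ρ) {x : Fin d → ℝ} {i : Fin d}
    (hx : 0 < x i) : df ρ x ≤ Real.exp (-(1 / x i)) := by
  rw [← frechet_of_pos hx, ← hm i]
  exact df_le_marg x i

theorem df_pos [IsProbabilityMeasure ρ] (hm : HasFrechetMarginals ρ) (hs : MaxStable ρ)
    {x : Fin d → ℝ} (hx : ∀ i, 0 < x i) : 0 < df ρ x := by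
  have h1 : Tendsto (fun t : ℝ => ∑ i, (1 - Real.exp (-(1 / (t * x i))))) atTop (𝓝 0) := by
    have h2 (i : Fin d) : Tendsto (fun t : ℝ => 1 - Real.exp (-(1 / (t * x i)))) atTop (𝓝 0) := by
      have h3 : Tendsto (fun t : ℝ => -(1 / (t * x i))) atTop (𝓝 0) := by
        simpa using ((tendsto_id.atTop_mul_const (hx i)).const_div_atTop (1 : ℝ)).neg
      simpa using (Real.continuous_exp.tendsto _ |>.comp h3).const_sub 1
    simpa using tendsto_finsetSum Finset.univ fun i _ => h2 i
  obtain ⟨t, ht, ht0⟩ := ((h1.eventually_lt_const one_pos).and (eventually_gt_atTop 0)).exists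
  have h2 := one_sub_df_le_sum (ρ := ρ) fun i => t * x i
  simp_rw [hm _ _, frechet_of_pos (mul_pos ht0 (hx _))] at h2
  have h3 : 0 < df ρ fun i => t * x i := by linarith
  rw [hs t ht0 x hx] at h3
  refine (df_nonneg x).lt_of_ne' fun h0 => ?_
  rw [h0, Real.zero_rpow (by positivity)] at h3
  exact h3.false

theorem df_lt_one [IsFiniteMeasure ρ] (hm : HasFrechetMarginals ρ) (hd : 1 ≤ d)
    {x : Fin d → ℝ} (hx : ∀ i, 0 < x i) : df ρ x < 1 := by
  have := hx ⟨0, hd⟩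
  exact (df_le_exp hm this).trans_lt (by simpa using this)

theorem log_df_mul (hs : MaxStable ρ) {t : ℝ} (ht : 0 < t) {x : Fin d → ℝ} (hx : ∀ i, 0 < x i)
    (hpos : 0 < df ρ x) : Real.log (df ρ fun i => t * x i) = 1 / t * Real.log (df ρ x) := by
  rw [hs t ht x hx, Real.log_rpow hpos]

theorem isOpen_posOrthant (d : ℕ) : IsOpen (posOrthant d) := by
  have : posOrthant d = Set.pi Set.univ fun _ => Set.Ioi (0 : ℝ) := by
    ext x
    simp [posOrthant]
  rw [this]
  exact isOpen_set_pi Set.finite_univ fun _ _ => isOpen_Ioi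

theorem continuousOn_df [IsProbabilityMeasure ρ] (hm : HasFrechetMarginals ρ) (hs : MaxStable ρ) :
    ContinuousOn (df ρ) (posOrthant d) := by
  intro x hx
  refine ContinuousAt.continuousWithinAt ?_
  have hpos := df_pos hm hs hx
  have hlim : Tendsto (fun t : ℝ => df ρ fun i => t * x i) (𝓝 1) (𝓝 (df ρ x)) := by
    have h1 : Tendsto (fun t : ℝ => df ρ x ^ (1 / t)) (𝓝 1) (𝓝 (df ρ x ^ (1 / 1 : ℝ))) :=
      (tendsto_const_nhds (x := df ρ x)).rpow
        (tendsto_const_nhds.div tendsto_id one_ne_zero) (Or.inl hpos.ne')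
    rw [div_one, Real.rpow_one] at h1
    refine h1.congr' ?_
    filter_upwards [lt_mem_nhds (zero_lt_one' ℝ)] with t ht
    exact (hs t ht x hx).symm
  have hnear (t : ℝ) (ht : t < 1) : ∀ᶠ y in 𝓝 x, ∀ i, t * x i < y i :=
    eventually_all.2 fun i => (continuous_apply i).continuousAt.eventually_const_lt
      (by nlinarith [hx i])
  have hnear' (t : ℝ) (ht : 1 < t) : ∀ᶠ y in 𝓝 x, ∀ i, y i < t * x i :=
    eventually_all.2 fun i => (continuous_apply i).continuousAt.eventually_lt_const
      (by nlinarith [hx i])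
  refine tendsto_order.2 ⟨fun a ha => ?_, fun a ha => ?_⟩
  · obtain ⟨t, h1, ht⟩ :=
      (((hlim.mono_left nhdsWithin_le_nhds).eventually_const_lt ha).and
        (self_mem_nhdsWithin (s := Set.Iio 1))).exists
    filter_upwards [hnear t ht] with y hy
    exact h1.trans_le (monotone_df fun i => (hy i).le)
  · obtain ⟨t, h1, ht⟩ :=
      (((hlim.mono_left nhdsWithin_le_nhds).eventually_lt_const ha).and
        (self_mem_nhdsWithin (s := Set.Ioi 1))).exists
    filter_upwards [hnear' t ht] with y hy
    exact (monotone_df fun i => (hy i).le).trans_lt h1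

/-- The logarithmic form of the convergence of powers defining a max-domain of attraction. -/
theorem tendsto_mul_one_sub_of_tendsto_pow {u : ℕ → ℝ} {h : ℝ} (hu0 : ∀ n, 0 ≤ u n) (hh : 0 < h)
    (hu : Tendsto (fun n => u n ^ n) atTop (𝓝 h)) :
    Tendsto (fun n : ℕ => n * (1 - u n)) atTop (𝓝 (-Real.log h)) := by
  have hlog : Tendsto (fun n : ℕ => n * Real.log (u n)) atTop (𝓝 (Real.log h)) := by
    simpa only [Real.log_pow] using hu.log hh.ne'
  have hpos : ∀ᶠ n in atTop, 0 < u n := by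
    filter_upwards [hu.eventually_const_lt hh, eventually_ne_atTop 0] with n hn hn0
    exact (hu0 n).lt_of_ne' fun h0 => by simp [h0, hn0] at hn
  have hlog0 : Tendsto (fun n => Real.log (u n)) atTop (𝓝 0) := by
    have := hlog.mul (tendsto_inv_atTop_nhds_zero_nat (𝕜 := ℝ))
    rw [mul_zero] at this
    refine this.congr' ?_
    filter_upwards [eventually_ne_atTop 0] with n hn
    field_simp
  have hone : Tendsto u atTop (𝓝 1) := by
    have := (Real.continuous_exp.tendsto 0).comp hlog0
    rw [Real.exp_zero] at this
    refine this.congr' ?_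
    filter_upwards [hpos] with n hn
    exact Real.exp_log hn
  have hlow : Tendsto (fun n : ℕ => u n * -(n * Real.log (u n))) atTop (𝓝 (-Real.log h)) := by
    simpa using hone.mul hlog.neg
  refine tendsto_of_tendsto_of_tendsto_of_le_of_le' hlow hlog.neg ?_ ?_
  · filter_upwards [hpos] with n hn
    have h1 := mul_le_mul_of_nonneg_left (Real.one_sub_inv_le_log_of_pos hn) hn.le
    rw [mul_sub, mul_inv_cancel₀ hn.ne'] at h1
    have := mul_le_mul_of_nonneg_left h1 (Nat.cast_nonneg (α := ℝ) n)
    linarith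
  · filter_upwards [hpos] with n hn
    have := mul_le_mul_of_nonneg_left (Real.log_le_sub_one_of_pos hn) (Nat.cast_nonneg (α := ℝ) n)
    linarith

theorem MDA.tendsto_mul_one_sub_df {ρH : Measure (Fin d → ℝ)} (h : MDA ρ ρH) {x : Fin d → ℝ}
    (hx : ∀ i, 0 < x i) (hpos : 0 < df ρH x) :
    Tendsto (fun n : ℕ => n * (1 - df ρ fun i => n * x i)) atTop (𝓝 (-Real.log (df ρH x))) :=
  tendsto_mul_one_sub_of_tendsto_pow (fun _ => df_nonneg _) hpos (h x hx)

end DistributionFunction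

section Tails

variable {d : ℕ} {ρF ρG ρH ρQ : Measure (Fin d → ℝ)}

theorem MDA.exists_one_sub_marg_le [IsProbabilityMeasure ρF] (h : MDA ρF ρH)
    (hpos : 0 < df ρH 1) (i : Fin d) :
    ∃ C, 0 ≤ C ∧ ∀ k : ℕ, (k + 1 : ℝ) * (1 - marg ρF i k) ≤ C := by
  obtain ⟨B, hB⟩ := (h.tendsto_mul_one_sub_df (fun _ => one_pos) hpos).bddAbove_range
  have hB' (k : ℕ) : (k : ℝ) * (1 - df ρF fun j => k * (1 : Fin d → ℝ) j) ≤ B := hB ⟨k, rfl⟩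
  have hB0 : 0 ≤ B := by simpa using hB' 0
  refine ⟨B + 1, by positivity, fun k => ?_⟩
  have h1 : (df ρF fun j => k * (1 : Fin d → ℝ) j) ≤ marg ρF i k := by
    simpa using df_le_marg (ρ := ρF) (fun j => k * (1 : Fin d → ℝ) j) i
  have h2 := marg_nonneg (ρ := ρF) i k
  have h3 := mul_le_mul_of_nonneg_left h1 (Nat.cast_nonneg (α := ℝ) k)
  linarith [hB' k]

theorem MDA.exists_le_one_sub_marg [IsProbabilityMeasure ρG] [IsProbabilityMeasure ρQ]
    (hm : HasFrechetMarginals ρQ) (hs : MaxStable ρQ) (h : MDA ρG ρQ) (i : Fin d) :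
    ∃ c, 0 < c ∧ ∀ t : ℝ, 0 ≤ t → c / (1 + t) ≤ 1 - marg ρG i t := by
  have hpos := df_pos hm hs (x := 1) fun _ => one_pos
  set L := -Real.log (df ρQ 1) with hL
  have hL0 : 0 ≤ L := neg_nonneg.2 (Real.log_nonpos hpos.le (df_le_one _))
  set K := 2 * L + 1 with hK
  have hK0 : 0 < K := by positivity
  have hKpos (j : Fin d) : 0 < K * (1 : Fin d → ℝ) j := by simpa using hK0
  set x : Fin d → ℝ := Function.update (fun j => K * (1 : Fin d → ℝ) j) i 1 with hx
  have hx0 (j) : 0 < x j := by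
    rcases eq_or_ne j i with rfl | hji
    · simp [hx]
    · simpa [hx, hji] using hK0
  have hxpos := df_pos hm hs hx0
  have hlim := (h.tendsto_mul_one_sub_df hx0 hxpos).sub
    (h.tendsto_mul_one_sub_df hKpos (df_pos hm hs hKpos))
  have hbound : 1 / 4 < -Real.log (df ρQ x) -
      -Real.log (df ρQ fun j => K * (1 : Fin d → ℝ) j) := by
    rw [log_df_mul hs hK0 (x := 1) (fun _ => one_pos) hpos]
    have h1 : Real.log (df ρQ x) ≤ -1 := by
      rw [Real.log_le_iff_le_exp hxpos]
      simpa [hx] using df_le_exp hm (hx0 i)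
    have h2 : 1 / K * L ≤ 1 / 2 := by
      rw [one_div, inv_mul_le_iff₀ hK0]
      linarith
    linarith
  obtain ⟨N, hN⟩ := eventually_atTop.1 (hlim.eventually_const_lt hbound)
  refine ⟨1 / (4 * (N + 2)), by positivity, fun t ht => ?_⟩
  set n := N + 1 + ⌈t⌉₊ with hn
  have hn0 : (0 : ℝ) < n := by positivity
  have htn : t ≤ n := (Nat.le_ceil t).trans (by rw [hn]; push_cast; linarith)
  have hnt : (n : ℝ) ≤ (N + 2) * (1 + t) := by
    have := (Nat.ceil_lt_add_one ht).le
    have hNt : 0 ≤ (N : ℝ) * t := by positivity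
    rw [hn]
    push_cast
    nlinarith
  have h1 := hN n (by omega)
  have h2 := one_sub_marg_ge (ρ := ρG) (x := fun j => n * x j)
    (z := fun j => n * (K * (1 : Fin d → ℝ) j)) i fun j hj => by simp [hx, hj]
  have h3 : marg ρG i t ≤ marg ρG i (n * x i) := monotone_marg i (by simpa [hx] using htn)
  have h4 := mul_le_mul_of_nonneg_left h2 hn0.le
  have h5 : 1 / 4 ≤ n * (1 - marg ρG i t) := by nlinarith
  have h6 : 0 ≤ 1 - marg ρG i t := by
    by_contra! hneg
    nlinarith
  rw [div_div, div_le_iff₀ (by positivity)]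
  nlinarith

theorem one_add_sq_le_sum {x : ℝ} (hx : 0 ≤ x) {M : ℕ} (hM : x ≤ M) :
    (1 + x) ^ 2 ≤ 1 + ∑ k ∈ Finset.range M, (2 * k + 3 : ℝ) * if (k : ℝ) < x then 1 else 0 := by
  have hsum (m : ℕ) : ∑ k ∈ Finset.range m, (2 * k + 3 : ℝ) = m ^ 2 + 2 * m := by
    induction m with
    | zero => simp
    | succ m ih =>
      rw [Finset.sum_range_succ, ih]
      push_cast
      ring
  calc (1 + x) ^ 2 ≤ (1 + ⌈x⌉₊) ^ 2 := by gcongr; exact Nat.le_ceil x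
    _ = 1 + ∑ k ∈ Finset.range ⌈x⌉₊, (2 * k + 3 : ℝ) := by rw [hsum]; ring
    _ = 1 + ∑ k ∈ Finset.range ⌈x⌉₊, (2 * k + 3 : ℝ) * if (k : ℝ) < x then 1 else 0 := by
      congr 1
      refine Finset.sum_congr rfl fun k hk => ?_
      rw [if_pos (Nat.lt_ceil.1 (Finset.mem_range.1 hk)), mul_one]
    _ ≤ _ := by
      gcongr
      exact Nat.ceil_le.2 hM

/-- The part of `n ∫ G ^ n dF` where one coordinate is at most `a n` is of order `a`. -/
theorem exists_setIntegral_df_pow_le [IsProbabilityMeasure ρF] [IsProbabilityMeasure ρG]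
    (hsupp : SupportedOnNonneg ρF) (i : Fin d) {C c : ℝ} (hC : 0 ≤ C) (hc : 0 < c)
    (hF : ∀ k : ℕ, (k + 1 : ℝ) * (1 - marg ρF i k) ≤ C)
    (hG : ∀ t : ℝ, 0 ≤ t → c / (1 + t) ≤ 1 - marg ρG i t) {a : ℝ} (ha : 0 < a) :
    ∀ᶠ n : ℕ in atTop, n * ∫ x in {x | x i ≤ a * n}, df ρG x ^ n ∂ρF ≤
      2 / c ^ 2 * (1 + 3 * C) * a := by
  filter_upwards [eventually_gt_atTop 0, tendsto_natCast_atTop_atTop.eventually_ge_atTop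
    ((1 + 3 * C) / a)] with n hn0 hn
  have hn0 : (0 : ℝ) < n := by exact_mod_cast hn0
  have hm (t : ℝ) : MeasurableSet {x : Fin d → ℝ | t < x i} :=
    measurableSet_lt measurable_const (measurable_pi_apply i)
  have hmA : MeasurableSet {x : Fin d → ℝ | x i ≤ a * n} :=
    measurableSet_le (measurable_pi_apply i) measurable_const
  set M := ⌈a * n⌉₊
  have hM : (M : ℝ) ≤ a * n + 1 := (Nat.ceil_lt_add_one (by positivity)).le
  set b : ℝ := 2 / (n * c) ^ 2
  set h : (Fin d → ℝ) → ℝ := fun x => b * (1 + ∑ k ∈ Finset.range M,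
    (2 * k + 3 : ℝ) * Set.indicator {x : Fin d → ℝ | (k : ℝ) < x i} 1 x) with hh
  have hki (k : ℕ) : Integrable (fun x => (2 * k + 3 : ℝ) *
      Set.indicator {x : Fin d → ℝ | (k : ℝ) < x i} 1 x) ρF :=
    ((integrable_const (1 : ℝ)).indicator (hm k)).const_mul _
  have hsi : Integrable (fun x => ∑ k ∈ Finset.range M, (2 * k + 3 : ℝ) *
      Set.indicator {x : Fin d → ℝ | (k : ℝ) < x i} 1 x) ρF :=
    integrable_finsetSum _ fun k _ => hki k
  have hhi : Integrable h ρF := ((integrable_const 1).add hsi).const_mul _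
  have hint : ∫ x, h x ∂ρF ≤ b * (1 + 3 * C * M) := by
    rw [hh, integral_const_mul, integral_add (integrable_const 1) hsi,
      integral_finsetSum _ fun k _ => hki k]
    simp_rw [integral_const_mul, fun k : ℕ => integral_indicator_one (μ := ρF) (hm k),
      measureReal_lt_eq_one_sub_marg]
    have : ∑ k ∈ Finset.range M, (2 * k + 3 : ℝ) * (1 - marg ρF i k) ≤
        ∑ k ∈ Finset.range M, 3 * C := by
      refine Finset.sum_le_sum fun k _ => ?_
      have h1 : 0 ≤ 1 - marg ρF i k := by
        rw [← measureReal_lt_eq_one_sub_marg]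
        exact measureReal_nonneg
      have h2 : 0 ≤ (k : ℝ) * (1 - marg ρF i k) := by positivity
      linarith [hF k]
    rw [Finset.sum_const, Finset.card_range, nsmul_eq_mul] at this
    rw [integral_const, probReal_univ, one_smul]
    gcongr
    linarith
  have hle : ∫ x in {x | x i ≤ a * n}, df ρG x ^ n ∂ρF ≤ ∫ x, h x ∂ρF := by
    rw [← integral_indicator hmA]
    refine integral_mono_of_nonneg (ae_of_all _ fun x =>
      Set.indicator_nonneg (fun _ _ => pow_nonneg (df_nonneg _) _) x) hhi ?_
    have hae : ∀ᵐ x ∂ρF, 0 ≤ x i := by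
      rw [ae_iff]
      have : {x : Fin d → ℝ | ¬0 ≤ x i} ⊆ {x | ∃ i, x i < 0} := fun x hx => ⟨i, not_le.1 hx⟩
      exact measure_mono_null this hsupp
    filter_upwards [hae] with x hx
    by_cases hxA : x i ≤ a * n
    · rw [Set.indicator_of_mem (by exact hxA)]
      have h1 : df ρG x ≤ Real.exp (-(c / (1 + x i))) := by
        have := Real.add_one_le_exp (-(c / (1 + x i)))
        linarith [hG _ hx, df_le_marg (ρ := ρG) x i]
      set y := n * c / (1 + x i) with hy
      have hy0 : 0 < y := by positivity
      calc df ρG x ^ n ≤ Real.exp (-(c / (1 + x i))) ^ n :=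
            pow_le_pow_left₀ (df_nonneg _) h1 n
        _ = (Real.exp y)⁻¹ := by
          rw [← Real.exp_nat_mul, ← Real.exp_neg, hy]
          ring_nf
        _ ≤ (y ^ 2 / 2)⁻¹ := by
          gcongr
          linarith [Real.quadratic_le_exp_of_nonneg hy0.le]
        _ = b * (1 + x i) ^ 2 := by simp only [hy, b]; field_simp
        _ ≤ b * (1 + ∑ k ∈ Finset.range M,
            (2 * k + 3 : ℝ) * if (k : ℝ) < x i then 1 else 0) := by
          gcongr
          exact one_add_sq_le_sum hx (hxA.trans (Nat.le_ceil _))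
        _ = h x := by simp [hh, Set.indicator_apply]
    · rw [Set.indicator_of_notMem (by exact hxA)]
      have : 0 ≤ ∑ k ∈ Finset.range M,
          (2 * k + 3 : ℝ) * Set.indicator {x : Fin d → ℝ | (k : ℝ) < x i} 1 x :=
        Finset.sum_nonneg fun k _ => mul_nonneg (by positivity)
          (Set.indicator_nonneg (fun _ _ => zero_le_one) _)
      positivity
  have hfin : 1 + 3 * C * M ≤ (1 + 3 * C) * (a * n) := by
    rw [div_le_iff₀ ha] at hn
    nlinarith
  calc n * ∫ x in {x | x i ≤ a * n}, df ρG x ^ n ∂ρF ≤ n * (b * (1 + 3 * C * M)) := by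
        gcongr
        exact hle.trans hint
    _ ≤ n * (b * ((1 + 3 * C) * (a * n))) := by gcongr
    _ = 2 / c ^ 2 * (1 + 3 * C) * a := by simp only [b]; field_simp

end Tails

section Rescaling

variable {d : ℕ} {ρF : Measure (Fin d → ℝ)}

/-- The measure `n ρ(n ·)`. -/
noncomputable def rescaledMeasure (ρ : Measure (Fin d → ℝ)) (n : ℕ) : Measure (Fin d → ℝ) :=
  (n : ℝ≥0∞) • ρ.map fun x i => (n : ℝ)⁻¹ * x i

instance [IsFiniteMeasure ρF] (n : ℕ) : IsFiniteMeasure (rescaledMeasure ρF n) :=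
  Measure.smul_finite _ (ENNReal.natCast_ne_top n)

theorem measurable_const_mul_pi (r : ℝ) : Measurable fun (x : Fin d → ℝ) i => r * x i :=
  Continuous.measurable (by fun_prop)

theorem rescaledMeasure_real_exists_lt [IsProbabilityMeasure ρF] (n : ℕ) (x : Fin d → ℝ) :
    (rescaledMeasure ρF n).real {y | ∃ i, x i < y i} = n * (1 - df ρF fun i => n * x i) := by
  rcases Nat.eq_zero_or_pos n with rfl | hn
  · simp [rescaledMeasure]
  have hn : (0 : ℝ) < n := by exact_mod_cast hn
  rw [rescaledMeasure, measureReal_ennreal_smul_apply,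
    map_measureReal_apply (measurable_const_mul_pi _) (measurableSet_exists_lt x),
    ← measureReal_exists_lt, ENNReal.toReal_natCast]
  congr 2
  ext y
  simp [lt_inv_mul_iff₀ hn]

theorem setIntegral_rescaledMeasure {n : ℕ} (hn : 0 < n) {g : (Fin d → ℝ) → ℝ}
    (hg : Continuous g) {s : Set (Fin d → ℝ)} (hs : MeasurableSet s) :
    ∫ x in s, g (fun i => n * x i) ∂(rescaledMeasure ρF n) =
      n * ∫ x in {x | (fun i => (n : ℝ)⁻¹ * x i) ∈ s}, g x ∂ρF := by
  have hn : (n : ℝ) ≠ 0 := by exact_mod_cast hn.ne'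
  have hg' : Continuous fun x : Fin d → ℝ => g fun i => n * x i := hg.comp (by fun_prop)
  rw [rescaledMeasure, Measure.restrict_smul, integral_smul_measure,
    setIntegral_map hs hg'.aestronglyMeasurable (measurable_const_mul_pi _).aemeasurable]
  simp only [mul_inv_cancel_left₀ hn, ENNReal.toReal_natCast, smul_eq_mul]
  rfl

end Rescaling

section Integrals

variable {d : ℕ} {ρF ρG ρH ρQ υ : Measure (Fin d → ℝ)}

theorem integrable_df_pow [IsFiniteMeasure ρF] [IsProbabilityMeasure ρG]
    (hc : Continuous (df ρG)) (n : ℕ) : Integrable (fun x => df ρG x ^ n) ρF :=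
  Integrable.of_bound (hc.pow n).aestronglyMeasurable 1 <| ae_of_all _ fun x => by
    rw [Real.norm_of_nonneg (pow_nonneg (df_nonneg _) _)]
    exact pow_le_one₀ (df_nonneg _) (df_le_one _)

theorem integral_df_pow_le [IsProbabilityMeasure ρF] [IsProbabilityMeasure ρG]
    (hc : Continuous (df ρG)) (n : ℕ) {s : Set (Fin d → ℝ)} (hs : MeasurableSet s) {r : ℝ}
    {u : Fin d → ℝ} (hsu : ∀ x, (∀ i, r < x i) → x ≤ u → x ∈ s) :
    ∫ x, df ρG x ^ n ∂ρF ≤ ∫ x in s, df ρG x ^ n ∂ρF +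
      ∑ i, ∫ x in {x | x i ≤ r}, df ρG x ^ n ∂ρF + (1 - df ρF u) := by
  have hm (i : Fin d) : MeasurableSet {x : Fin d → ℝ | x i ≤ r} :=
    measurableSet_le (measurable_pi_apply i) measurable_const
  have hi := integrable_df_pow (ρF := ρF) hc n
  have h1 : Integrable (fun x => ∑ i, Set.indicator {x : Fin d → ℝ | x i ≤ r}
      (fun x => df ρG x ^ n) x) ρF := integrable_finsetSum _ fun i _ => hi.indicator (hm i)
  have h2 : Integrable (Set.indicator {x | ∃ i, u i < x i} (1 : (Fin d → ℝ) → ℝ)) ρF :=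
    (integrable_const (1 : ℝ)).indicator (measurableSet_exists_lt u)
  have hnn (x) : 0 ≤ df ρG x ^ n := pow_nonneg (df_nonneg _) _
  rw [← measureReal_exists_lt, ← integral_indicator_one (measurableSet_exists_lt u),
    ← integral_indicator hs]
  simp_rw [fun i => (integral_indicator (μ := ρF) (f := fun x => df ρG x ^ n) (hm i)).symm]
  rw [← integral_finsetSum _ fun i _ => hi.indicator (hm i),
    ← integral_add (hi.indicator hs) h1]
  refine (integral_mono hi (((hi.indicator hs).add h1).add h2) fun x => ?_).trans_eq
    (integral_add ((hi.indicator hs).add h1) h2)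
  have n1 : 0 ≤ Set.indicator s (fun x => df ρG x ^ n) x :=
    Set.indicator_nonneg (fun x _ => hnn x) x
  have n2 (i) : 0 ≤ Set.indicator {x : Fin d → ℝ | x i ≤ r} (fun x => df ρG x ^ n) x :=
    Set.indicator_nonneg (fun x _ => hnn x) x
  have n3 : 0 ≤ Set.indicator {x | ∃ i, u i < x i} (1 : (Fin d → ℝ) → ℝ) x :=
    Set.indicator_nonneg (fun x _ => zero_le_one) x
  have n4 := Finset.sum_nonneg fun i (_ : i ∈ Finset.univ) => n2 i
  change df ρG x ^ n ≤ Set.indicator s (fun x => df ρG x ^ n) x +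
    ∑ i, Set.indicator {x : Fin d → ℝ | x i ≤ r} (fun x => df ρG x ^ n) x +
    Set.indicator {x | ∃ i, u i < x i} (1 : (Fin d → ℝ) → ℝ) x
  by_cases hxu : ∃ i, u i < x i
  · have : Set.indicator {x | ∃ i, u i < x i} (1 : (Fin d → ℝ) → ℝ) x = 1 :=
      Set.indicator_of_mem (by exact hxu) _
    linarith [pow_le_one₀ (n := n) (df_nonneg x) (df_le_one (ρ := ρG) x)]
  by_cases hxr : ∃ i, x i ≤ r
  · obtain ⟨i, hxi⟩ := hxr
    have h3 := Finset.single_le_sum (fun i _ => n2 i) (Finset.mem_univ i)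
    rw [Set.indicator_of_mem (by exact hxi)] at h3
    linarith
  push Not at hxu hxr
  rw [Set.indicator_of_mem (hsu x hxr hxu)]
  linarith

/-- The boxes exhausting the positive orthant. -/
noncomputable def exhaustingBox (d m : ℕ) : BoxIntegral.Box (Fin d) where
  lower _ := 1 / (m + 2)
  upper _ := m + 2
  lower_lt_upper _ := by
    rw [div_lt_iff₀ (by positivity)]
    nlinarith [(Nat.cast_nonneg m : (0 : ℝ) ≤ m)]

theorem exhaustingBox_lower_pos (m : ℕ) (i : Fin d) : 0 < (exhaustingBox d m).lower i := by
  simp only [exhaustingBox]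
  positivity

theorem exhaustingBox_Icc_subset (m : ℕ) :
    BoxIntegral.Box.Icc (exhaustingBox d m) ⊆ posOrthant d :=
  fun _ hx i => (exhaustingBox_lower_pos m i).trans_le (hx.1 i)

theorem exhaustingBox_subset (m : ℕ) : (exhaustingBox d m : Set (Fin d → ℝ)) ⊆ posOrthant d :=
  (exhaustingBox d m).coe_subset_Icc.trans (exhaustingBox_Icc_subset m)

theorem aecover_exhaustingBox (μ : Measure (Fin d → ℝ)) :
    AECover (μ.restrict (posOrthant d)) atTop fun m => (exhaustingBox d m : Set (Fin d → ℝ)) where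
  ae_eventually_mem := by
    filter_upwards [ae_restrict_mem (isOpen_posOrthant d).measurableSet] with x hx
    have h (i : Fin d) : ∀ᶠ m : ℕ in atTop, 1 / ((m : ℝ) + 2) < x i ∧ x i ≤ m + 2 := by
      have h1 : Tendsto (fun m : ℕ => (m : ℝ) + 2) atTop atTop :=
        tendsto_atTop_add_const_right _ _ tendsto_natCast_atTop_atTop
      exact ((h1.const_div_atTop 1).eventually_lt_const (hx i)).and (h1.eventually_ge_atTop _)
    exact eventually_all.2 h
  measurableSet m := (exhaustingBox d m).measurableSet_coe

theorem IsExponentMeasure.measure_exists_lt_ne_top [IsProbabilityMeasure ρH] (hd : 1 ≤ d)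
    (hm : HasFrechetMarginals ρH) (hs : MaxStable ρH) (h : IsExponentMeasure ρH υ)
    {x : Fin d → ℝ} (hx : ∀ i, 0 < x i) : υ {y | ∃ i, x i < y i} ≠ ∞ := by
  intro htop
  have h1 := h x hx
  rw [htop, ENNReal.toReal_top] at h1
  linarith [Real.log_neg (df_pos hm hs hx) (df_lt_one hm hd hx)]

theorem IsExponentMeasure.tendsto_setIntegral_exhaustingBox
    [IsProbabilityMeasure ρH] [IsProbabilityMeasure ρQ]
    [IsProbabilityMeasure ρF] [IsProbabilityMeasure ρG] (hd : 1 ≤ d)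
    (hHm : HasFrechetMarginals ρH) (hQm : HasFrechetMarginals ρQ)
    (hHs : MaxStable ρH) (hQs : MaxStable ρQ) (hexp : IsExponentMeasure ρH υ)
    (hGcont : Continuous (df ρG)) (hF : MDA ρF ρH) (hG : MDA ρG ρQ) (m : ℕ) :
    IntegrableOn (df ρQ) (exhaustingBox d m) υ ∧
    Tendsto (fun n : ℕ => n *
        ∫ x in {x | (fun i => (n : ℝ)⁻¹ * x i) ∈ (exhaustingBox d m : Set (Fin d → ℝ))},
          df ρG x ^ n ∂ρF) atTop
      (𝓝 (∫ x in exhaustingBox d m, df ρQ x ∂υ)) := by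
  set I := exhaustingBox d m
  have hfin (x : Fin d → ℝ) (hx : ∀ i, 0 < x i) : υ {y | ∃ i, x i < y i} ≠ ∞ :=
    hexp.measure_exists_lt_ne_top hd hHm hHs hx
  have hconv (x : Fin d → ℝ) (hx : ∀ i, 0 < x i) :
      Tendsto (fun n => (rescaledMeasure ρF n).real {y | ∃ i, x i < y i}) atTop
        (𝓝 (υ.real {y | ∃ i, x i < y i})) := by
    simp_rw [rescaledMeasure_real_exists_lt]
    rw [measureReal_def, hexp x hx]
    exact hF.tendsto_mul_one_sub_df hx (df_pos hHm hHs hx)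
  have hIfin : υ I ≠ ∞ := by
    have : (I : Set (Fin d → ℝ)) ⊆ {y | ∃ i, I.lower i < y i} :=
      fun y hy => ⟨⟨0, hd⟩, (hy _).1⟩
    exact measure_ne_top_of_subset this (hfin _ (exhaustingBox_lower_pos m))
  have hQi : IntegrableOn (df ρQ) I υ := by
    have : IsFiniteMeasure (υ.restrict I) := isFiniteMeasure_restrict.2 hIfin
    refine Integrable.of_bound ?_ 1 (ae_of_all _ fun x => ?_)
    · exact ((continuousOn_df hQm hQs).mono (exhaustingBox_subset m)).aestronglyMeasurable
        I.measurableSet_coe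
    · rw [Real.norm_of_nonneg (df_nonneg _)]
      exact df_le_one _
  refine ⟨hQi, ?_⟩
  have hscale (n : ℕ) : Monotone fun (x : Fin d → ℝ) i => (n : ℝ) * x i :=
    fun x y hxy i => mul_le_mul_of_nonneg_left (hxy i) n.cast_nonneg
  have hmain := tendsto_setIntegral_box I (μ := rescaledMeasure ρF) (ν := υ)
    (g := fun n x => df ρG (fun i => n * x i) ^ n) (f := df ρQ)
    (fun n => inferInstance) hIfin (fun J hJ => ?_)
    (fun n x y hxy => pow_le_pow_left₀ (df_nonneg _) (monotone_df (hscale n hxy)) n) monotone_df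
    (fun n => ?_) hQi ((continuousOn_df hQm hQs).mono (exhaustingBox_Icc_subset m))
    (fun x hx => hG x (exhaustingBox_Icc_subset m hx))
  · refine hmain.congr' ?_
    filter_upwards [eventually_gt_atTop 0] with n hn
    exact setIntegral_rescaledMeasure hn (hGcont.pow n) I.measurableSet_coe
  · have hJset : (J : Set (Fin d → ℝ)) =
        {y | y ≤ J.upper ∧ ∀ i ∈ Finset.univ, J.lower i < y i} := by
      ext y
      simp [BoxIntegral.Box.mem_def, Pi.le_def, forall_and, and_comm]
    rw [hJset]
    exact tendsto_measureReal_partialBox (fun n => inferInstance) hfin hconv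
      ⟨⟨0, hd⟩, Finset.mem_univ _⟩ _ _
      (fun i => (exhaustingBox_lower_pos m i).trans_le
        ((BoxIntegral.Box.le_iff_bounds.1 hJ).1 i)) J.lower_le_upper
  · refine Integrable.integrableOn (Integrable.of_bound
      ((hGcont.comp (by fun_prop)).pow n).aestronglyMeasurable 1 (ae_of_all _ fun x => ?_))
    rw [Real.norm_of_nonneg (pow_nonneg (df_nonneg _) _)]
    exact pow_le_one₀ (df_nonneg _) (df_le_one _)

/-- The mass of `n ∫ G ^ n dF` outside the rescaled exhausting boxes is uniformly small. -/
theorem exists_mul_integral_df_pow_le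
    [IsProbabilityMeasure ρH] [IsProbabilityMeasure ρQ]
    [IsProbabilityMeasure ρF] [IsProbabilityMeasure ρG]
    (hHm : HasFrechetMarginals ρH) (hQm : HasFrechetMarginals ρQ)
    (hHs : MaxStable ρH) (hQs : MaxStable ρQ) (hFsupp : SupportedOnNonneg ρF)
    (hGcont : Continuous (df ρG)) (hF : MDA ρF ρH) (hG : MDA ρG ρQ) :
    ∃ C : ℝ, ∀ m : ℕ, ∀ᶠ n : ℕ in atTop, n * ∫ x, df ρG x ^ n ∂ρF ≤
      n * ∫ x in {x | (fun i => (n : ℝ)⁻¹ * x i) ∈ (exhaustingBox d m : Set (Fin d → ℝ))},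
        df ρG x ^ n ∂ρF + C * (1 / (m + 2)) := by
  have hpos := df_pos hHm hHs (x := 1) fun _ => one_pos
  have hC (i : Fin d) : ∃ C : ℝ, ∀ a : ℝ, 0 < a → ∀ᶠ n : ℕ in atTop,
      n * ∫ x in {x | x i ≤ a * n}, df ρG x ^ n ∂ρF ≤ C * a := by
    obtain ⟨B, hB0, hB⟩ := hF.exists_one_sub_marg_le hpos i
    obtain ⟨c, hc0, hc⟩ := hG.exists_le_one_sub_marg hQm hQs i
    exact ⟨_, fun a ha => exists_setIntegral_df_pow_le hFsupp i hB0 hc0 hB hc ha⟩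
  choose C hC using hC
  refine ⟨∑ i, C i + (-Real.log (df ρH 1) + 1), fun m => ?_⟩
  have hK0 : (0 : ℝ) < m + 2 := by positivity
  have ha0 : (0 : ℝ) < 1 / (m + 2) := by positivity
  have hlim := hF.tendsto_mul_one_sub_df (x := fun i => (m + 2) * (1 : Fin d → ℝ) i)
    (fun i => by simpa using hK0) (df_pos hHm hHs fun i => by simpa using hK0)
  rw [log_df_mul hHs hK0 (x := 1) (fun _ => one_pos) hpos] at hlim
  filter_upwards [eventually_gt_atTop 0, eventually_all.2 fun i => hC i _ ha0,
    hlim.eventually_le_const (lt_add_of_pos_right _ ha0)] with n hn h1 h2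
  have hn : (0 : ℝ) < n := by exact_mod_cast hn
  have h3 := integral_df_pow_le (ρF := ρF) hGcont n (r := 1 / ((m : ℝ) + 2) * n)
    (u := fun i => n * ((m + 2) * (1 : Fin d → ℝ) i))
    (s := {x | (fun i => (n : ℝ)⁻¹ * x i) ∈ (exhaustingBox d m : Set (Fin d → ℝ))})
    (measurable_const_mul_pi _ (exhaustingBox d m).measurableSet_coe) fun x hr hu i => by
      constructor
      · rw [lt_inv_mul_iff₀ hn, mul_comm]
        exact hr i
      · rw [inv_mul_le_iff₀ hn]
        simpa [exhaustingBox] using hu i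
  have h4 := mul_le_mul_of_nonneg_left h3 hn.le
  have h5 := Finset.sum_le_sum fun i (_ : i ∈ Finset.univ) => h1 i
  rw [mul_add, mul_add, Finset.mul_sum] at h4
  rw [← Finset.sum_mul] at h5
  linarith

end Integrals

/-- For `H, Q` max-stable with unit Fréchet marginals, `υ` an exponent
measure of `H`, and `F ∈ MDA(H)`, `G ∈ MDA(Q)` continuous dfs of probability measures
on `[0,∞)^d` with tail-equivalent marginals,
`lim_n n ∫ G(x)^n dρ_F(x) = ∫_{(0,∞)^d} Q dυ = λ(Q,H)`. -/
theorem stmt5 {d : ℕ} (hd : 1 ≤ d)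
    (ρH ρQ ρF ρG : Measure (Fin d → ℝ))
    [IsProbabilityMeasure ρH] [IsProbabilityMeasure ρQ]
    [IsProbabilityMeasure ρF] [IsProbabilityMeasure ρG]
    (hHm : HasFrechetMarginals ρH) (hQm : HasFrechetMarginals ρQ)
    (hHms : MaxStable ρH) (hQms : MaxStable ρQ)
    (υ : Measure (Fin d → ℝ)) (hexp : IsExponentMeasure ρH υ)
    (hFsupp : SupportedOnNonneg ρF) (hGsupp : SupportedOnNonneg ρG)
    (hFcont : Continuous (df ρF)) (hGcont : Continuous (df ρG))
    (hFmda : MDA ρF ρH) (hGmda : MDA ρG ρQ)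
    (c : Fin d → ℝ) (hc : ∀ i, 0 < c i)
    (htail : ∀ i, Tendsto (fun x : ℝ => (1 - marg ρF i x) / (1 - marg ρG i x))
      atTop (𝓝 (c i))) :
    Tendsto (fun n : ℕ => (n : ℝ) * ∫ x, (df ρG x) ^ n ∂ρF) atTop
      (𝓝 (∫ x in posOrthant d, df ρQ x ∂υ)) := by
  have hbox := hexp.tendsto_setIntegral_exhaustingBox hd hHm hQm hHms hQms hGcont hFmda hGmda
  obtain ⟨C, hC⟩ :=
    exists_mul_integral_df_pow_le hHm hQm hHms hQms hFsupp hGcont hFmda hGmda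
  have hlow (m n : ℕ) :
      n * ∫ x in {x | (fun i => (n : ℝ)⁻¹ * x i) ∈ (exhaustingBox d m : Set (Fin d → ℝ))},
        df ρG x ^ n ∂ρF ≤ n * ∫ x, df ρG x ^ n ∂ρF :=
    mul_le_mul_of_nonneg_left (setIntegral_le_integral (integrable_df_pow hGcont n)
      (ae_of_all _ fun x => pow_nonneg (df_nonneg _) _)) n.cast_nonneg
  have hcover := aecover_exhaustingBox υ
  have hrestrict (m : ℕ) : (υ.restrict (posOrthant d)).restrict (exhaustingBox d m) =
      υ.restrict (exhaustingBox d m) :=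
    Measure.restrict_restrict_of_subset (exhaustingBox_subset m)
  have hint : Integrable (df ρQ) (υ.restrict (posOrthant d)) := by
    refine hcover.integrable_of_integral_bounded_of_nonneg_ae
      (∫ x in exhaustingBox d 0, df ρQ x ∂υ + C * (1 / ((0 : ℕ) + 2)))
      (fun m => ?_) (ae_of_all _ df_nonneg) (Eventually.of_forall fun m => ?_)
    · rw [IntegrableOn, hrestrict]
      exact (hbox m).1
    · rw [hrestrict]
      refine le_of_tendsto_of_tendsto (hbox m).2 ((hbox 0).2.add_const _) ?_
      filter_upwards [hC 0] with n hn using (hlow m n).trans hn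
  have hlim := hcover.integral_tendsto_of_countably_generated hint
  simp_rw [hrestrict] at hlim
  have herr : Tendsto (fun m : ℕ => C * (1 / ((m : ℝ) + 2))) atTop (𝓝 0) := by
    simpa using ((tendsto_atTop_add_const_right _ 2
      (tendsto_natCast_atTop_atTop (R := ℝ))).const_div_atTop 1).const_mul C
  have hupp := hlim.add herr
  rw [add_zero] at hupp
  refine tendsto_order.2 ⟨fun a ha => ?_, fun a ha => ?_⟩
  · obtain ⟨m, hm⟩ := (hlim.eventually_const_lt ha).exists
    filter_upwards [(hbox m).2.eventually_const_lt hm] with n hn using hn.trans_le (hlow m n)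
  · obtain ⟨m, hm⟩ := (hupp.eventually_lt_const ha).exists
    filter_upwards [((hbox m).2.add_const _).eventually_lt_const hm, hC m] with n hn hn'
      using hn'.trans_lt hn
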